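/- Let p be a partition of an odd integer 2n+1 that is orthogonal, i.e., every even part of p occurs with even multiplicity. Then ((p⁻)_C)ᵗ = ((pᵗ)⁻)_C; that is, first decreasing the smallest part by 1, then taking the C-collapse, then transposing, gives the same partition as first transposing, then decreasing the smallest part by 1, then taking the C-collapse. -/

import Mathlib

/-- A partition: a finite multiset of positive integers. -/
def IsPartition (p : Multiset ℕ) : Prop := ∀ x ∈ p, 0 < x

/-- The parts of `p` in weakly decreasing order. -/
def descList (p : Multiset ℕ) : List ℕ := (p.sort (· ≤ ·)).reverse

/-- The sum of the `j` largest parts of `p` (padding with trailing zeros). -/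
def topSum (p : Multiset ℕ) (j : ℕ) : ℕ := ((descList p).take j).sum

/-- Dominance order: `DomLE α β` means `α ≤ β`, i.e. each partial sum of the
largest parts of `α` is at most the corresponding partial sum for `β`. -/
def DomLE (α β : Multiset ℕ) : Prop := ∀ j : ℕ, topSum α j ≤ topSum β j

/-- Transpose of a partition: the `j`-th part is the number of parts `≥ j`. -/
def transposeP (p : Multiset ℕ) : Multiset ℕ :=
  ((Multiset.range p.sum).map fun j => (p.filter fun x => j + 1 ≤ x).card).filter
    fun c => c ≠ 0

/-- The weakly decreasing list of parts padded with zeros to length `n`. -/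
def padDesc (p : Multiset ℕ) (n : ℕ) : List ℕ :=
  descList p ++ List.replicate (n - Multiset.card p) 0

/-- The sum of two partitions: add the parts pointwise after sorting in
weakly decreasing order and padding with trailing zeros. -/
def sumParts (p q : Multiset ℕ) : Multiset ℕ :=
  (↑(List.zipWith (· + ·)
      (padDesc p (max (Multiset.card p) (Multiset.card q)))
      (padDesc q (max (Multiset.card p) (Multiset.card q)))) : Multiset ℕ).filter
    fun x => x ≠ 0

/-- The string `[a] = (a, a-2, a-4, …, 2 or 1)`, empty for `a = 0`. -/
def strP (a : ℕ) : Multiset ℕ := (Multiset.range ((a + 1) / 2)).map fun k => a - 2 * k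

/-- The partition `(a, a-1, …, 2, 1)`. -/
def downP (a : ℕ) : Multiset ℕ := (Multiset.range a).map fun k => a - k

/-- The partition `(2a-1, 2a-3, …, 3, 1)`. -/
def oddsDown (a : ℕ) : Multiset ℕ := (Multiset.range a).map fun k => 2 * (a - k) - 1

/-- The partition `(2a, 2a-2, …, 4, 2)`. -/
def evensDown (a : ℕ) : Multiset ℕ := (Multiset.range a).map fun k => 2 * (a - k)

/-- `p⁻`: decrease the smallest part of `p` by 1 (deleting it if it was 1). -/
def pMinus (p : Multiset ℕ) : Multiset ℕ :=
  match p.sort (· ≤ ·) with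
  | [] => 0
  | a :: rest => (↑rest : Multiset ℕ) + (if a ≤ 1 then 0 else {a - 1})

/-- A partition is symplectic if every odd part occurs with even multiplicity. -/
def IsSymplectic (p : Multiset ℕ) : Prop := ∀ x : ℕ, Odd x → Even (p.count x)

/-- A partition is orthogonal if every even part occurs with even multiplicity. -/
def IsOrthogonal (p : Multiset ℕ) : Prop := ∀ x : ℕ, Even x → Even (p.count x)

/-- `IsCCollapse p q`: `q` is the C-collapse `p_C` of `p`, i.e. the unique maximal
symplectic partition of the same total that is `≤ p` in the dominance order. -/
def IsCCollapse (p q : Multiset ℕ) : Prop :=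
  IsPartition q ∧ IsSymplectic q ∧ q.sum = p.sum ∧ DomLE q p ∧
    ∀ r : Multiset ℕ, IsPartition r → IsSymplectic r → r.sum = p.sum → DomLE r p → DomLE r q

/-- The `i`-th largest part of `p` (indexed from `0`, padded with zeros). -/
def row (p : Multiset ℕ) (i : ℕ) : ℕ := (descList p).getD i 0

/-- The number of parts of `p` exceeding `k`, i.e. the `k`-th row of the transpose. -/
def col (p : Multiset ℕ) (k : ℕ) : ℕ := (p.filter fun x => k + 1 ≤ x).card

/-- The sum of the first `j` rows of the transpose of `p`. -/
def colSum (p : Multiset ℕ) (j : ℕ) : ℕ := (p.map fun x => min x j).sum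

/-- The partition whose nonzero parts are the nonzero values of `d` on `0, …, N - 1`. -/
def ofRows (N : ℕ) (d : ℕ → ℕ) : Multiset ℕ :=
  ((Multiset.range N).map d).filter fun c => c ≠ 0

theorem coe_descList (p : Multiset ℕ) : (descList p : Multiset ℕ) = p := by
  simp [descList]

theorem pairwise_descList (p : Multiset ℕ) : (descList p).Pairwise (· ≥ ·) := by
  rw [descList, List.pairwise_reverse]
  exact p.pairwise_sort (· ≤ ·)

theorem descList_coe_eq {l : List ℕ} (hl : l.Pairwise (· ≥ ·)) :
    descList (l : Multiset ℕ) = l :=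
  List.Perm.eq_of_pairwise' (pairwise_descList _) hl
    (Multiset.coe_eq_coe.1 (coe_descList _))

theorem List.sum_take_eq_sum_getD (l : List ℕ) (j : ℕ) :
    (l.take j).sum = ∑ i ∈ Finset.range j, l.getD i 0 := by
  induction l generalizing j with
  | nil => simp
  | cons a t ih =>
    cases j with
    | zero => simp
    | succ j => simp [Finset.sum_range_succ', ih, add_comm]

theorem List.sum_map_eq_sum_getD (l : List ℕ) {f : ℕ → ℕ} (hf : f 0 = 0) {N : ℕ}
    (hN : l.length ≤ N) : (l.map f).sum = ∑ i ∈ Finset.range N, f (l.getD i 0) := by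
  induction l generalizing N with
  | nil => simp [hf]
  | cons a t ih =>
    cases N with
    | zero => simp at hN
    | succ N =>
      have := ih (N := N) (by simpa using hN)
      simp [Finset.sum_range_succ', this, add_comm]

theorem List.lt_countP_iff_of_pairwise_ge {l : List ℕ} (hl : l.Pairwise (· ≥ ·)) (i k : ℕ) :
    i < l.countP (fun x => k + 1 ≤ x) ↔ k < l.getD i 0 := by
  induction l generalizing i with
  | nil => simp
  | cons a t ih =>
    rw [List.pairwise_cons] at hl
    by_cases h : k + 1 ≤ a
    · rw [List.countP_cons_of_pos (by simpa using h)]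
      cases i with
      | zero => simpa using h
      | succ i => simpa using ih hl.2 i
    · have h0 : t.countP (fun x => k + 1 ≤ x) = 0 := by
        rw [List.countP_eq_zero]
        intro x hx
        have := hl.1 x hx
        simp only [decide_eq_true_eq]
        omega
      rw [List.countP_cons_of_neg (by simpa using h), h0]
      cases i with
      | zero => simp; omega
      | succ i =>
        have := ih hl.2 i
        rw [h0] at this
        simpa using this

theorem topSum_eq_sum_row (p : Multiset ℕ) (j : ℕ) :
    topSum p j = ∑ i ∈ Finset.range j, row p i :=
  List.sum_take_eq_sum_getD _ _

theorem topSum_zero (p : Multiset ℕ) : topSum p 0 = 0 := by simp [topSum]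

theorem topSum_succ (p : Multiset ℕ) (j : ℕ) : topSum p (j + 1) = topSum p j + row p j := by
  simp [topSum_eq_sum_row, Finset.sum_range_succ]

theorem length_descList (p : Multiset ℕ) : (descList p).length = p.card := by
  simp [descList]

theorem sum_map_eq_sum_row (p : Multiset ℕ) {f : ℕ → ℕ} (hf : f 0 = 0) {N : ℕ}
    (hN : p.card ≤ N) : (p.map f).sum = ∑ i ∈ Finset.range N, f (row p i) := by
  rw [← length_descList] at hN
  refine Eq.trans ?_ (List.sum_map_eq_sum_getD _ hf hN)
  conv_lhs => rw [← coe_descList p]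
  simp

theorem sum_eq_topSum (p : Multiset ℕ) {N : ℕ} (hN : p.card ≤ N) : topSum p N = p.sum := by
  rw [topSum_eq_sum_row]
  simpa using (sum_map_eq_sum_row p (f := id) rfl hN).symm

theorem lt_col_iff (p : Multiset ℕ) (i k : ℕ) : i < col p k ↔ k < row p i := by
  have : col p k = (descList p).countP (fun x => k + 1 ≤ x) := by
    rw [col, ← Multiset.countP_eq_card_filter]
    conv_lhs => rw [← coe_descList p]
    simp
  rw [this]
  exact List.lt_countP_iff_of_pairwise_ge (pairwise_descList p) i k

theorem row_eq_of_lt_col_iff {p : Multiset ℕ} {d : ℕ → ℕ}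
    (h : ∀ i k, i < col p k ↔ k < d i) : row p = d := by
  funext i
  exact eq_of_forall_lt_iff fun k => by rw [← lt_col_iff, h]

theorem row_antitone (p : Multiset ℕ) : Antitone (row p) := by
  intro i j hij
  by_contra! h
  have := (lt_col_iff p j _).2 h
  exact lt_irrefl _ ((lt_col_iff p i _).1 (hij.trans_lt this))

theorem col_antitone (p : Multiset ℕ) : Antitone (col p) := by
  intro i j hij
  by_contra! h
  have := (lt_col_iff p _ _).1 h
  exact lt_irrefl _ ((lt_col_iff p _ _).2 (hij.trans_lt this))

theorem row_eq_zero {p : Multiset ℕ} {i : ℕ} (hi : p.card ≤ i) : row p i = 0 := by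
  rw [row, List.getD_eq_default]
  rwa [length_descList]

theorem col_cons (a : ℕ) (s : Multiset ℕ) (k : ℕ) :
    col (a ::ₘ s) k = (if k + 1 ≤ a then 1 else 0) + col s k := by
  rw [col, Multiset.filter_cons, Multiset.card_add, col]
  split_ifs <;> rfl

theorem colSum_cons (a : ℕ) (s : Multiset ℕ) (k : ℕ) :
    colSum (a ::ₘ s) k = min a k + colSum s k := by
  simp [colSum]

theorem count_add_col (p : Multiset ℕ) (v : ℕ) :
    p.count (v + 1) + col p (v + 1) = col p v := by
  induction p using Multiset.induction_on with
  | empty => simp [col]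
  | cons a s ih =>
    simp only [Multiset.count_cons, col_cons]
    split_ifs <;> omega

theorem colSum_succ (p : Multiset ℕ) (j : ℕ) : colSum p (j + 1) = colSum p j + col p j := by
  induction p using Multiset.induction_on with
  | empty => simp [colSum, col]
  | cons a s ih =>
    rw [colSum_cons, colSum_cons, col_cons, ih]
    split_ifs <;> omega

theorem colSum_zero (p : Multiset ℕ) : colSum p 0 = 0 := by simp [colSum]

theorem eq_of_topSum_eq {p q : Multiset ℕ} (hp : IsPartition p) (hq : IsPartition q)
    (h : ∀ j, topSum p j = topSum q j) : p = q := by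
  have hr : row p = row q := by
    funext i
    have := h (i + 1)
    rw [topSum_succ, topSum_succ, h i] at this
    omega
  have hc : col p = col q := by
    funext k
    exact eq_of_forall_lt_iff fun i => by rw [lt_col_iff, lt_col_iff, hr]
  ext v
  cases v with
  | zero =>
    rw [Multiset.count_eq_zero_of_notMem fun h0 => lt_irrefl _ (hp 0 h0),
      Multiset.count_eq_zero_of_notMem fun h0 => lt_irrefl _ (hq 0 h0)]
  | succ v =>
    have h1 := count_add_col p v
    have h2 := count_add_col q v
    rw [hc] at h1
    omega

theorem topSum_add_colSum_le (p : Multiset ℕ) (j v : ℕ) :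
    topSum p j + colSum p v ≤ j * v + p.sum := by
  have hN : p.card ≤ j + p.card := Nat.le_add_left _ _
  rw [← sum_eq_topSum p hN, colSum, sum_map_eq_sum_row p (f := fun x => min x v) (by simp) hN,
    topSum_eq_sum_row, topSum_eq_sum_row, Finset.sum_range_add, Finset.sum_range_add]
  have h1 : ∑ i ∈ Finset.range j, min (row p i) v ≤ ∑ i ∈ Finset.range j, v :=
    Finset.sum_le_sum fun i _ => min_le_right _ _
  have h2 : ∑ i ∈ Finset.range p.card, min (row p (j + i)) v ≤
      ∑ i ∈ Finset.range p.card, row p (j + i) := Finset.sum_le_sum fun i _ => min_le_left _ _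
  simp only [Finset.sum_const, Finset.card_range, smul_eq_mul] at h1
  omega

theorem topSum_add_colSum_eq {p : Multiset ℕ} {j v : ℕ} (hj : row p j ≤ v)
    (hv : ∀ i < j, v ≤ row p i) : topSum p j + colSum p v = j * v + p.sum := by
  have hN : p.card ≤ j + p.card := Nat.le_add_left _ _
  rw [← sum_eq_topSum p hN, colSum, sum_map_eq_sum_row p (f := fun x => min x v) (by simp) hN,
    topSum_eq_sum_row, topSum_eq_sum_row, Finset.sum_range_add, Finset.sum_range_add]
  have h1 : ∑ i ∈ Finset.range j, min (row p i) v = ∑ i ∈ Finset.range j, v :=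
    Finset.sum_congr rfl fun i hi => min_eq_right (hv i (Finset.mem_range.1 hi))
  have h2 : ∑ i ∈ Finset.range p.card, min (row p (j + i)) v =
      ∑ i ∈ Finset.range p.card, row p (j + i) :=
    Finset.sum_congr rfl fun i _ =>
      min_eq_left ((row_antitone p (Nat.le_add_right j i)).trans hj)
  simp only [Finset.sum_const, Finset.card_range, smul_eq_mul] at h1
  omega

theorem domLE_of_colSum_le {p q : Multiset ℕ} (hs : p.sum = q.sum)
    (h : ∀ j, colSum q j ≤ colSum p j) : DomLE p q := by
  intro j
  have h1 := topSum_add_colSum_le p j (row q j)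
  have h2 := topSum_add_colSum_eq (le_refl (row q j)) fun i hi => row_antitone q hi.le
  have := h (row q j)
  omega

theorem colSum_le_of_domLE {p q : Multiset ℕ} (hs : p.sum = q.sum) (h : DomLE p q) (v : ℕ) :
    colSum q v ≤ colSum p v := by
  have h1 := topSum_add_colSum_le q (col p v) v
  have h2 := topSum_add_colSum_eq (p := p) (j := col p v) (v := v)
    (not_lt.1 fun hlt => lt_irrefl _ ((lt_col_iff p _ _).2 hlt))
    fun i hi => ((lt_col_iff p _ _).1 hi).le
  have := h (col p v)
  omega

theorem isPartition_ofRows (N : ℕ) (d : ℕ → ℕ) : IsPartition (ofRows N d) := by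
  intro x hx
  exact Nat.pos_of_ne_zero (Multiset.mem_filter.1 hx).2

theorem row_ofRows {N : ℕ} {d : ℕ → ℕ} (hd : Antitone d) (hN : ∀ i, N ≤ i → d i = 0) :
    row (ofRows N d) = d := by
  apply row_eq_of_lt_col_iff
  intro i k
  have hc : col (ofRows N d) k = ((Finset.range N).filter fun i => k + 1 ≤ d i).card := by
    rw [col, ofRows, Multiset.filter_filter, Multiset.filter_map, Multiset.card_map,
      Finset.card_def, Finset.filter_val, Finset.range_val]
    congr 1
    apply Multiset.filter_congr
    intro x _
    simp only [Function.comp_apply]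
    omega
  rw [hc]
  constructor
  · intro h
    by_contra! hk
    have hsub : ((Finset.range N).filter fun i => k + 1 ≤ d i) ⊆ Finset.range i := by
      intro x hx
      rw [Finset.mem_filter] at hx
      rw [Finset.mem_range]
      by_contra! hix
      have := hd hix
      omega
    have := Finset.card_le_card hsub
    rw [Finset.card_range] at this
    omega
  · intro h
    have hsub : Finset.range (i + 1) ⊆ ((Finset.range N).filter fun i => k + 1 ≤ d i) := by
      intro x hx
      rw [Finset.mem_range] at hx
      have := hd (Nat.le_of_lt_succ hx)
      rw [Finset.mem_filter, Finset.mem_range]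
      refine ⟨?_, by omega⟩
      by_contra! hNx
      have := hN x hNx
      omega
    have := Finset.card_le_card hsub
    rw [Finset.card_range] at this
    omega

theorem row_transposeP (p : Multiset ℕ) : row (transposeP p) = col p := by
  refine row_ofRows (N := p.sum) (col_antitone p) fun i hi => ?_
  rw [Multiset.card_eq_zero, Multiset.filter_eq_nil]
  intro x hx
  have := Multiset.single_le_sum (fun _ _ => Nat.zero_le _) x hx
  omega

theorem col_transposeP (p : Multiset ℕ) : col (transposeP p) = row p := by
  funext k
  exact eq_of_forall_lt_iff fun i => by rw [lt_col_iff, row_transposeP, lt_col_iff]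

theorem topSum_transposeP (p : Multiset ℕ) (j : ℕ) : topSum (transposeP p) j = colSum p j := by
  induction j with
  | zero => rw [topSum_zero, colSum_zero]
  | succ j ih => rw [topSum_succ, colSum_succ, ih, row_transposeP]

theorem colSum_transposeP (p : Multiset ℕ) (j : ℕ) : colSum (transposeP p) j = topSum p j := by
  induction j with
  | zero => rw [topSum_zero, colSum_zero]
  | succ j ih => rw [topSum_succ, colSum_succ, ih, col_transposeP]

theorem isPartition_transposeP (p : Multiset ℕ) : IsPartition (transposeP p) :=
  isPartition_ofRows _ _

theorem colSum_eq_sum {p : Multiset ℕ} {N : ℕ} (hN : p.sum ≤ N) : colSum p N = p.sum := by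
  rw [colSum, Multiset.map_congr rfl fun x hx => min_eq_left
    ((Multiset.single_le_sum (fun _ _ => Nat.zero_le _) x hx).trans hN)]
  simp

theorem sum_transposeP (p : Multiset ℕ) : (transposeP p).sum = p.sum := by
  rw [← sum_eq_topSum (transposeP p) (le_max_left _ p.sum), topSum_transposeP,
    colSum_eq_sum (le_max_right _ _)]

theorem even_sum_map {p : Multiset ℕ} {f : ℕ → ℕ}
    (h : ∀ x, Even (p.count x) ∨ Even (f x)) : Even (p.map f).sum := by
  rw [Finset.sum_multiset_map_count]
  refine Finset.even_sum _ fun x _ => ?_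
  rw [smul_eq_mul, Nat.even_mul]
  exact h x

theorem colSum_add_sum_tsub (p : Multiset ℕ) (v : ℕ) :
    colSum p v + (p.map fun x => x - v).sum = p.sum := by
  rw [colSum, ← Multiset.sum_map_add]
  conv_rhs => rw [← Multiset.map_id p]
  congr 1
  exact Multiset.map_congr rfl fun x _ => by simp only [id]; omega

theorem topSum_succ_eq {p : Multiset ℕ} {j v : ℕ} (h1 : row p (j + 1) ≤ v) (h2 : v ≤ row p j) :
    topSum p (j + 1) = (j + 1) * v + (p.map fun x => x - v).sum := by
  have h := topSum_add_colSum_eq h1 fun i hi =>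
    h2.trans (row_antitone p (Nat.le_of_lt_succ hi))
  have := colSum_add_sum_tsub p v
  omega

theorem IsOrthogonal.even_topSum_iff {p : Multiset ℕ} (hp : IsOrthogonal p) {j : ℕ}
    (h : Odd (row p j) ∨ row p j ≠ row p (j + 1)) : Even (topSum p (j + 1)) ↔ Even (j + 1) := by
  have hanti := row_antitone p (Nat.le_succ j)
  obtain ⟨v, hv, h1, h2⟩ : ∃ v, Odd v ∧ row p (j + 1) ≤ v ∧ v ≤ row p j := by
    rcases Nat.even_or_odd (row p j) with he | ho
    · have := h.resolve_left (Nat.not_odd_iff_even.2 he)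
      refine ⟨row p j - 1, Nat.Even.sub_odd ?_ he odd_one, ?_, ?_⟩ <;>
        simp only [Nat.succ_eq_add_one] at * <;> omega
    · exact ⟨_, ho, hanti, le_rfl⟩
  have hs : Even (p.map fun x => x - v).sum := even_sum_map fun x => by
    rcases Nat.even_or_odd x with hx | hx
    · exact Or.inl (hp x hx)
    · exact Or.inr (Nat.Odd.sub_odd hx hv)
  rw [topSum_succ_eq h1 h2, Nat.even_add, Nat.even_mul]
  simp [hs, Nat.not_even_iff_odd.2 hv]

theorem IsSymplectic.even_topSum {p : Multiset ℕ} (hp : IsSymplectic p) {j : ℕ}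
    (h : row p j ≠ row p (j + 1)) : Even (topSum p (j + 1)) := by
  have hanti := row_antitone p (Nat.le_succ j)
  obtain ⟨v, hv, h1, h2⟩ : ∃ v, Even v ∧ row p (j + 1) ≤ v ∧ v ≤ row p j := by
    rcases Nat.even_or_odd (row p j) with he | ho
    · exact ⟨_, he, hanti, le_rfl⟩
    · refine ⟨row p j - 1, Nat.Odd.sub_odd ho odd_one, ?_, ?_⟩ <;>
        simp only [Nat.succ_eq_add_one] at * <;> omega
  have hs : Even (p.map fun x => x - v).sum := even_sum_map fun x => by
    rcases Nat.even_or_odd x with hx | hx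
    · rcases le_total v x with hvx | hvx
      · exact Or.inr ((Nat.even_sub hvx).2 (by simp [hx, hv]))
      · exact Or.inr (by simp [Nat.sub_eq_zero_of_le hvx])
    · exact Or.inl (hp x hx)
  rw [topSum_succ_eq h1 h2, Nat.even_add, Nat.even_mul]
  simp [hs, hv]

theorem isSymplectic_of_even_topSum {p : Multiset ℕ}
    (h : ∀ j, Even (topSum p (j + 1)) ∨ row p j = row p (j + 1)) : IsSymplectic p := by
  have hcol : ∀ v, Even (topSum p (col p v)) := by
    intro v
    rcases hc : col p v with _ | c
    · simp [topSum_zero]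
    · refine (h c).resolve_right fun he => ?_
      have h1 := (lt_col_iff p c v).1 (by omega)
      rw [he, ← lt_col_iff] at h1
      omega
  intro x hx
  obtain ⟨v, rfl⟩ : ∃ v, x = v + 1 := ⟨x - 1, by have := hx.pos; omega⟩
  have hcount := count_add_col p v
  have hsum : topSum p (col p v) = topSum p (col p (v + 1)) + p.count (v + 1) * (v + 1) := by
    rw [← hcount, add_comm, topSum_eq_sum_row, topSum_eq_sum_row, Finset.sum_range_add]
    congr 1
    rw [Finset.sum_congr rfl (g := fun _ => v + 1), Finset.sum_const, Finset.card_range,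
      smul_eq_mul]
    intro i hi
    rw [Finset.mem_range] at hi
    have h1 := (lt_col_iff p (col p (v + 1) + i) v).1 (by omega)
    have h2 := mt (lt_col_iff p (col p (v + 1) + i) (v + 1)).2 (by omega)
    omega
  have h3 := hcol v
  rw [hsum, Nat.even_add, Nat.even_mul] at h3
  simpa [hcol (v + 1), Nat.not_even_iff_odd.2 hx] using h3

/-- The rows `s` of the transpose of a symplectic partition satisfy
`s₁ + ⋯ + s_j ≡ j s_j` modulo `2`. -/
theorem IsSymplectic.even_colSum_iff {p : Multiset ℕ} (hp : IsSymplectic p) (j : ℕ) :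
    Even (colSum p (j + 1)) ↔ Even ((j + 1) * col p j) := by
  have h : colSum p (j + 1) =
      (j + 1) * col p j + (p.map fun x => if x ≤ j then x else 0).sum := by
    clear hp
    induction p using Multiset.induction_on with
    | empty => simp [colSum, col]
    | cons a s ih =>
      rw [colSum_cons, col_cons, ih, Multiset.map_cons, Multiset.sum_cons]
      rcases le_or_gt a j with ha | ha
      · rw [min_eq_left (by omega), if_neg (by omega), if_pos ha]
        ring
      · rw [min_eq_right (by omega), if_pos (by omega), if_neg (by omega)]
        ring
  have he : Even (p.map fun x => if x ≤ j then x else 0).sum := even_sum_map fun x => by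
    rcases Nat.even_or_odd x with hx | hx
    · right
      split_ifs
      · exact hx
      · exact Even.zero
    · exact Or.inl (hp x hx)
  rw [h, Nat.even_add]
  simp [he]

theorem isSymplectic_transposeP {p : Multiset ℕ}
    (h : ∀ j, Even (topSum p (j + 1)) ↔ Even ((j + 1) * row p j)) :
    IsSymplectic (transposeP p) := by
  intro x hx
  obtain ⟨v, rfl⟩ : ∃ v, x = v + 1 := ⟨x - 1, by have := hx.pos; omega⟩
  have hc := count_add_col (transposeP p) v
  rw [col_transposeP] at hc
  have h1 := h v
  have h2 := h (v + 1)
  rw [topSum_succ, Nat.even_add, h1, Nat.even_mul, Nat.even_mul] at h2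
  rw [← hc] at h2
  have hx' := hx.add_one
  have hx'' := Nat.not_even_iff_odd.2 hx
  simp only [hx', hx'', Nat.even_add, true_or, false_or, iff_true] at h2
  tauto

theorem exists_sum_map_pMinus {p : Multiset ℕ} (hp : IsPartition p) (h0 : p ≠ 0) :
    ∃ a, 0 < a ∧ (∀ x ∈ p, a ≤ x) ∧ ∀ f : ℕ → ℕ, f 0 = 0 →
      ((pMinus p).map f).sum + f a = (p.map f).sum + f (a - 1) := by
  have hs := p.pairwise_sort (· ≤ ·)
  have he := p.sort_eq (· ≤ ·)
  rw [pMinus]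
  rcases hl : p.sort (· ≤ ·) with _ | ⟨a, t⟩
  · rw [hl] at he
    exact absurd he.symm h0
  · rw [hl] at hs he
    rw [List.pairwise_cons] at hs
    have ha : 0 < a := hp a (by simp [← he])
    refine ⟨a, ha, fun x hx => ?_, fun f hf => ?_⟩
    · rw [← he] at hx
      rcases List.mem_cons.1 (Multiset.mem_coe.1 hx) with rfl | hx
      · exact le_rfl
      · exact hs.1 x hx
    · rw [← he]
      simp only
      split_ifs with h1
      · have : a = 1 := by omega
        simp [this, hf, add_comm]
      · simp
        ring

theorem sum_pMinus {p : Multiset ℕ} (hp : IsPartition p) (h0 : p ≠ 0) :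
    (pMinus p).sum + 1 = p.sum := by
  obtain ⟨a, ha, -, h⟩ := exists_sum_map_pMinus hp h0
  have := h id rfl
  simp only [Multiset.map_id] at this
  simp only [id] at this
  omega

theorem topSum_pMinus {p : Multiset ℕ} (hp : IsPartition p) (h0 : p ≠ 0) (j : ℕ) :
    topSum (pMinus p) j = if j < p.card then topSum p j else p.sum - 1 := by
  have hsum := sum_pMinus hp h0
  have hs := p.pairwise_sort (· ≤ ·)
  have he := p.sort_eq (· ≤ ·)
  have hpm : pMinus p = match p.sort (· ≤ ·) with
    | [] => 0
    | a :: rest => (↑rest : Multiset ℕ) + (if a ≤ 1 then 0 else {a - 1}) := rfl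
  have hd : descList p = (p.sort (· ≤ ·)).reverse := rfl
  rcases hl : p.sort (· ≤ ·) with _ | ⟨a, t⟩
  · rw [hl] at he
    exact absurd he.symm h0
  rw [hl] at hs he hpm hd
  simp only at hpm
  have hcard : p.card = t.length + 1 := by simp [← he]
  obtain ⟨l, hl2, hlen⟩ : ∃ l : List ℕ, descList (pMinus p) = t.reverse ++ l ∧ l.length ≤ 1 := by
    rw [List.pairwise_cons] at hs
    rw [hpm]
    split_ifs with h1
    · refine ⟨[], ?_, by simp⟩
      rw [add_zero, List.append_nil, ← Multiset.coe_reverse]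
      exact descList_coe_eq (List.pairwise_reverse.2 hs.2)
    · refine ⟨[a - 1], ?_, by simp⟩
      rw [← Multiset.coe_reverse, ← Multiset.coe_singleton, Multiset.coe_add]
      apply descList_coe_eq
      rw [List.pairwise_append]
      refine ⟨List.pairwise_reverse.2 hs.2, by simp, fun x hx y hy => ?_⟩
      have := hs.1 x (List.mem_reverse.1 hx)
      rw [List.mem_singleton] at hy
      omega
  split_ifs with hj
  · rw [topSum, topSum, hl2, hd, List.reverse_cons, List.take_append_of_le_length,
      List.take_append_of_le_length] <;> simp <;> omega
  · rw [sum_eq_topSum]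
    · omega
    · rw [← length_descList, hl2, List.length_append, List.length_reverse]
      omega

/-- The amount by which the `j`-th partial sum of `p` drops under
`p ↦ (p⁻)_C`, for `p` a partition of an odd integer. -/
def defect (p : Multiset ℕ) : ℕ → ℕ
  | 0 => 0
  | j + 1 =>
    if Odd (topSum p (j + 1)) ∧ (Even (row p j) ∨ row p j ≠ row p (j + 1)) then 1 else 0

theorem defect_succ (p : Multiset ℕ) (j : ℕ) : defect p (j + 1) =
    if Odd (topSum p (j + 1)) ∧ (Even (row p j) ∨ row p j ≠ row p (j + 1)) then 1 else 0 :=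
  rfl

theorem defect_le_one (p : Multiset ℕ) (j : ℕ) : defect p j ≤ 1 := by
  cases j with
  | zero => exact zero_le_one
  | succ j => rw [defect_succ]; split_ifs <;> omega

theorem odd_topSum_of_defect {p : Multiset ℕ} {j : ℕ} (h : defect p j = 1) :
    Odd (topSum p j) := by
  cases j with
  | zero => cases h
  | succ j =>
    rw [defect_succ] at h
    by_contra hc
    simp [hc] at h

theorem defect_le_topSum (p : Multiset ℕ) (j : ℕ) : defect p j ≤ topSum p j := by
  have h1 := defect_le_one p j
  rcases Nat.eq_zero_or_pos (defect p j) with h | h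
  · omega
  · have := (odd_topSum_of_defect (p := p) (j := j) (by omega)).pos
    omega

theorem defect_succ_of_even {p : Multiset ℕ} {j : ℕ} (h : Even (row p j)) :
    defect p (j + 1) = defect p j := by
  rw [defect_succ]
  have hpar : Odd (topSum p (j + 1)) ↔ Odd (topSum p j) := by
    rw [topSum_succ]; simp [Nat.odd_add, h]
  cases j with
  | zero => simp [hpar, topSum_zero, defect]
  | succ j =>
    rw [defect_succ]
    have h' : Even (row p j) ∨ row p j ≠ row p (j + 1) := by
      by_contra! hc
      exact hc.1 (hc.2 ▸ h)
    simp [hpar, h, h']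

theorem defect_of_card_le {p : Multiset ℕ} (hodd : Odd p.sum) {j : ℕ} (hj : p.card ≤ j) :
    defect p j = 1 := by
  cases j with
  | zero =>
    rw [Multiset.card_eq_zero.1 (Nat.le_zero.1 hj)] at hodd
    simp at hodd
  | succ j =>
    rw [defect_succ, sum_eq_topSum p hj, row_eq_zero hj, if_pos]
    refine ⟨hodd, ?_⟩
    rcases Nat.eq_zero_or_pos (row p j) with h | h
    · left; simp [h]
    · right; omega

theorem defect_succ_le (p : Multiset ℕ) (j : ℕ) : defect p (j + 1) ≤ defect p j + row p j := by
  rcases Nat.eq_zero_or_pos (row p j) with h | h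
  · rw [defect_succ_of_even (by simp [h])]
    omega
  · have := defect_le_one p (j + 1)
    omega

/-- The rows of `(p⁻)_C`. -/
def collapseRow (p : Multiset ℕ) (j : ℕ) : ℕ := row p j + defect p j - defect p (j + 1)

theorem collapseRow_antitone (p : Multiset ℕ) : Antitone (collapseRow p) := by
  refine antitone_nat_of_succ_le fun j => ?_
  have h0 := defect_succ_le p j
  have h1 := defect_succ_le p (j + 1)
  have h2 := row_antitone p (Nat.le_succ j)
  have h3 := defect_le_one p (j + 1)
  have h4 := defect_le_one p j
  simp only [collapseRow, Nat.succ_eq_add_one] at *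
  rcases Nat.eq_zero_or_pos (defect p (j + 1)) with he | he
  · omega
  have hd : Even (row p j) ∨ row p j ≠ row p (j + 1) := by
    rw [defect_succ] at he
    by_contra hc
    simp [hc] at he
  rcases Nat.even_or_odd (row p j) with h5 | h5
  · have h6 := defect_succ_of_even h5
    rcases Nat.even_or_odd (row p (j + 1)) with h7 | h7
    · have h8 := defect_succ_of_even h7
      omega
    · have : row p j ≠ row p (j + 1) := by
        intro hc
        rw [hc] at h5
        exact Nat.not_even_iff_odd.2 h7 h5
      omega
  · have h6 := hd.resolve_left (Nat.not_even_iff_odd.2 h5)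
    rcases Nat.even_or_odd (row p (j + 1)) with h7 | h7
    · have h8 := defect_succ_of_even h7
      omega
    · have := Nat.Odd.sub_odd h5 h7
      obtain ⟨k, hk⟩ := this
      omega

/-- The explicit collapse `(p⁻)_C`. -/
def collapseMinus (p : Multiset ℕ) : Multiset ℕ := ofRows p.card (collapseRow p)

theorem row_collapseMinus {p : Multiset ℕ} (hodd : Odd p.sum) :
    row (collapseMinus p) = collapseRow p := by
  refine row_ofRows (collapseRow_antitone p) fun i hi => ?_
  rw [collapseRow, row_eq_zero hi, defect_of_card_le hodd hi,
    defect_of_card_le hodd (hi.trans (Nat.le_succ i))]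

theorem topSum_collapseMinus {p : Multiset ℕ} (hodd : Odd p.sum) (j : ℕ) :
    topSum (collapseMinus p) j + defect p j = topSum p j := by
  induction j with
  | zero => simp [topSum_zero, defect]
  | succ j ih =>
    have := defect_succ_le p j
    rw [topSum_succ, topSum_succ, row_collapseMinus hodd, collapseRow]
    omega

theorem sum_collapseMinus {p : Multiset ℕ} (hodd : Odd p.sum) :
    (collapseMinus p).sum + 1 = p.sum := by
  have h := topSum_collapseMinus hodd (max (collapseMinus p).card p.card)
  rwa [sum_eq_topSum _ (le_max_left _ _), sum_eq_topSum _ (le_max_right _ _),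
    defect_of_card_le hodd (le_max_right _ _)] at h

theorem even_topSum_collapseMinus_iff {p : Multiset ℕ} (hodd : Odd p.sum) (j : ℕ) :
    Even (topSum (collapseMinus p) (j + 1)) ↔
      Even (topSum p (j + 1)) ∨ Even (row p j) ∨ row p j ≠ row p (j + 1) := by
  have h := topSum_collapseMinus hodd (j + 1)
  rw [defect_succ] at h
  split_ifs at h with hc
  · have hev := hc.1
    rw [← h] at hev
    simp [show Even (topSum (collapseMinus p) (j + 1)) by simpa [Nat.odd_add_one] using hev, hc.2]
  · rw [add_zero] at h
    rw [← Nat.not_even_iff_odd] at hc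
    rw [h]
    tauto

theorem isSymplectic_collapseMinus {p : Multiset ℕ} (hodd : Odd p.sum) :
    IsSymplectic (collapseMinus p) := by
  refine isSymplectic_of_even_topSum fun j => ?_
  rw [even_topSum_collapseMinus_iff hodd]
  by_contra! hc
  obtain ⟨⟨h1, h2, h3⟩, h4⟩ := hc
  refine h4 ?_
  have hj : ∀ i, ¬ Odd (topSum p i) → defect p i = 0 := fun i hi => by
    have := defect_le_one p i
    by_contra h
    exact hi (odd_topSum_of_defect (by omega))
  have e1 : defect p (j + 1) = 0 := by
    rw [defect_succ, if_neg]
    tauto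
  have e0 : defect p j = 0 := hj j fun ho => by
    rw [topSum_succ] at h1
    exact h1 (ho.add_odd (Nat.not_even_iff_odd.1 h2))
  have e2 : defect p (j + 2) = 0 := hj _ fun ho => by
    rw [topSum_succ, ← h3] at ho
    exact Nat.not_even_iff_odd.2 ho ((Nat.not_even_iff_odd.1 h1).add_odd
      (Nat.not_even_iff_odd.1 h2))
  rw [row_collapseMinus hodd, collapseRow, collapseRow, e0, e1, e2, h3]

theorem defect_eq_zero_of_topSum_eq {p q : Multiset ℕ} (hq : IsSymplectic q)
    (hle : DomLE q p) (j : ℕ) (h : topSum q j = topSum p j) : defect p j = 0 := by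
  induction j with
  | zero => rfl
  | succ j ih =>
    have h0 := hle j
    have h2 := hle (j + 2)
    rw [topSum_succ _ (j + 1), topSum_succ _ (j + 1)] at h2
    have h1 := h
    rw [topSum_succ, topSum_succ] at h1
    have hp := row_antitone p (Nat.le_succ j)
    rw [defect_succ, if_neg]
    rintro ⟨ho, hc⟩
    have hq' : row q j = row q (j + 1) := by
      by_contra hne
      have := hq.even_topSum hne
      rw [h] at this
      exact Nat.not_even_iff_odd.2 ho this
    simp only [Nat.succ_eq_add_one] at hp
    have hp' : row p j = row p (j + 1) := by omega
    have he := hc.resolve_right (not_not.2 hp')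
    have hz := ih (by omega)
    rw [← defect_succ_of_even he, defect_succ, if_pos ⟨ho, hc⟩] at hz
    cases hz

theorem ne_zero_of_odd_sum {p : Multiset ℕ} (hodd : Odd p.sum) : p ≠ 0 := by
  rintro rfl
  simp at hodd

theorem isCCollapse_collapseMinus {p : Multiset ℕ} (hp : IsPartition p) (hodd : Odd p.sum) :
    IsCCollapse (pMinus p) (collapseMinus p) := by
  have h0 := ne_zero_of_odd_sum hodd
  have hs := sum_pMinus hp h0
  have hs' := sum_collapseMinus hodd
  refine ⟨isPartition_ofRows _ _, isSymplectic_collapseMinus hodd, by omega, fun j => ?_,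
    fun r _ hr _ hle j => ?_⟩
  · have h := topSum_collapseMinus hodd j
    rw [topSum_pMinus hp h0]
    split_ifs with hj
    · omega
    · rw [sum_eq_topSum p (not_lt.1 hj), defect_of_card_le hodd (not_lt.1 hj)] at h
      omega
  · have hle' : DomLE r p := fun i => by
      have h := hle i
      rw [topSum_pMinus hp h0] at h
      split_ifs at h with hi
      · exact h
      · rw [sum_eq_topSum p (not_lt.1 hi)]
        omega
    have h := topSum_collapseMinus hodd j
    have h1 := defect_le_one p j
    have h2 := hle' j
    by_contra! hlt
    have := defect_eq_zero_of_topSum_eq hr hle' j (by omega)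
    omega

theorem IsCCollapse.unique {p q r : Multiset ℕ} (hq : IsCCollapse p q) (hr : IsCCollapse p r) :
    q = r := by
  obtain ⟨q1, q2, q3, q4, q5⟩ := hq
  obtain ⟨r1, r2, r3, r4, r5⟩ := hr
  exact eq_of_topSum_eq q1 r1 fun j => le_antisymm (r5 q q1 q2 q3 q4 j) (q5 r r1 r2 r3 r4 j)

theorem isSymplectic_transposeP_collapseMinus {p : Multiset ℕ} (hodd : Odd p.sum)
    (horth : IsOrthogonal p) : IsSymplectic (transposeP (collapseMinus p)) := by
  refine isSymplectic_transposeP fun j => ?_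
  rw [even_topSum_collapseMinus_iff hodd, row_collapseMinus hodd, Nat.even_mul, collapseRow]
  have ho := horth.even_topSum_iff (j := j)
  have h1 := defect_le_one p j
  have h3 := defect_succ_le p j
  rcases Nat.even_or_odd (row p j) with h | h
  · rw [defect_succ_of_even h]
    simp [h]
  · have hS := ho (Or.inl h)
    have hodd0 : Odd (topSum p j) ↔ Even (j + 1) := by
      rw [← hS, topSum_succ, Nat.even_add']
      simp [h]
    by_cases hj : Even (j + 1)
    · simp [hj, hS]
    · have e0 : defect p j = 0 := by
        by_contra hne
        exact hj (hodd0.1 (odd_topSum_of_defect (by omega)))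
      have hS' : Odd (topSum p (j + 1)) := by rwa [← Nat.not_even_iff_odd, hS]
      have hn := Nat.not_even_iff_odd.2 h
      rw [e0, defect_succ]
      by_cases hr : row p j = row p (j + 1)
      · have hn' : ¬ Even (row p (j + 1)) := hr ▸ hn
        simp [hj, hS, hr, hn']
      · simp [hj, hr, hS', Nat.Odd.sub_odd h odd_one]

/-- Bounds for the partial sums of the transpose of `(pᵗ)⁻`. -/
theorem colSum_pMinus_transposeP {p : Multiset ℕ} (hodd : Odd p.sum) (j : ℕ) :
    topSum p j ≤ colSum (pMinus (transposeP p)) j + 1 ∧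
      colSum (pMinus (transposeP p)) j + defect p j ≤ topSum p j := by
  have h0 : transposeP p ≠ 0 := ne_zero_of_odd_sum (by rwa [sum_transposeP])
  obtain ⟨a, ha, hmin, h⟩ := exists_sum_map_pMinus (isPartition_transposeP p) h0
  have hj := h (fun x => min x j) (by simp)
  change colSum _ _ + _ = colSum _ _ + _ at hj
  rw [colSum_transposeP] at hj
  refine ⟨by omega, ?_⟩
  have hd := defect_le_one p j
  suffices j < a → defect p j = 0 by
    by_cases hja : j < a
    · have := this hja
      omega
    · omega
  intro hja
  cases j with
  | zero => rfl
  | succ j =>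
    have hrow : ∀ i ≤ j + 1, row p i = row p 0 := by
      intro i hi
      refine le_antisymm (row_antitone p (Nat.zero_le i)) ?_
      by_contra! hlt
      have hpos : 0 < col p (row p 0 - 1) := (lt_col_iff p _ _).2 (by omega)
      have hr : row p 0 - 1 < p.sum := by
        have : row p 0 ≤ p.sum := by
          have h1 := topSum_add_colSum_le p 1 0
          have h2 : topSum p 1 = row p 0 := by rw [topSum_succ, topSum_zero, zero_add]
          omega
        omega
      have hmem : col p (row p 0 - 1) ∈ transposeP p :=
        Multiset.mem_filter.2
          ⟨Multiset.mem_map.2 ⟨_, Multiset.mem_range.2 hr, rfl⟩, hpos.ne'⟩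
      have h3 := hmin _ hmem
      have h4 := (lt_col_iff p i (row p 0 - 1)).1 (by omega)
      omega
    rw [defect_succ, if_neg]
    rintro ⟨ho, hc⟩
    have he : Even (row p j) := hc.resolve_right
      (not_not.2 (by rw [hrow j (by omega), hrow (j + 1) le_rfl]))
    rw [topSum_eq_sum_row, Finset.sum_congr rfl fun i hi =>
      (hrow i (Finset.mem_range.1 hi).le), ← hrow j (by omega)] at ho
    simp only [Finset.sum_const, smul_eq_mul] at ho
    exact Nat.not_even_iff_odd.2 ho (he.mul_left _)

theorem topSum_collapseMinus_le_colSum {p r : Multiset ℕ} (hodd : Odd p.sum)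
    (horth : IsOrthogonal p) (hr : IsSymplectic r) (h : ∀ j, topSum p j ≤ colSum r j + 1)
    (j : ℕ) : topSum (collapseMinus p) j ≤ colSum r j := by
  have hD := topSum_collapseMinus hodd j
  by_contra! hlt
  have hj := h j
  have he : defect p j = 0 := by omega
  have hS : topSum p j = colSum r j + 1 := by omega
  cases j with
  | zero => simp [topSum_zero] at hS
  | succ j =>
    have h0 := h j
    have h2 := h (j + 2)
    have hpar := hr.even_colSum_iff j
    rw [Nat.even_mul] at hpar
    have hS' : Odd (topSum p (j + 1)) ↔ Even (colSum r (j + 1)) := by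
      rw [hS]; simp [Nat.odd_add_one]
    rw [topSum_succ, colSum_succ] at h2
    have hS2 := hS
    rw [topSum_succ, colSum_succ] at hS2
    have hc := col_antitone r (Nat.le_succ j)
    simp only [Nat.succ_eq_add_one] at hc
    have hd : ¬ (Odd (topSum p (j + 1)) ∧ (Even (row p j) ∨ row p j ≠ row p (j + 1))) := by
      intro hcon
      rw [defect_succ, if_pos hcon] at he
      cases he
    have ho := horth.even_topSum_iff (j := j)
    rw [← Nat.not_odd_iff_even] at ho
    by_cases hrow : row p j = row p (j + 1)
    · have hcr : col r j = row p j := by omega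
      rw [hcr] at hpar
      rw [← Nat.not_even_iff_odd (n := row p j)] at ho
      tauto
    · tauto

theorem isCCollapse_transposeP_collapseMinus {p : Multiset ℕ} (hodd : Odd p.sum)
    (horth : IsOrthogonal p) :
    IsCCollapse (pMinus (transposeP p)) (transposeP (collapseMinus p)) := by
  have h0 : transposeP p ≠ 0 := ne_zero_of_odd_sum (by rwa [sum_transposeP])
  have hs := sum_pMinus (isPartition_transposeP p) h0
  have hs' := sum_collapseMinus hodd
  rw [sum_transposeP] at hs
  refine ⟨isPartition_transposeP _, isSymplectic_transposeP_collapseMinus hodd horth,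
    by rw [sum_transposeP]; omega, domLE_of_colSum_le (by rw [sum_transposeP]; omega) fun j => ?_,
    fun r _ hr hrs hle => domLE_of_colSum_le (by rw [hrs, sum_transposeP]; omega) fun j => ?_⟩
  · rw [colSum_transposeP]
    have h1 := (colSum_pMinus_transposeP hodd j).2
    have h2 := topSum_collapseMinus hodd j
    omega
  · rw [colSum_transposeP]
    refine topSum_collapseMinus_le_colSum hodd horth hr (fun i => ?_) j
    have h1 := (colSum_pMinus_transposeP hodd i).1
    have h2 := colSum_le_of_domLE hrs hle i
    omega

/-- for an orthogonal partition `p` of an odd integer,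
`((p⁻)_C)ᵗ = ((pᵗ)⁻)_C`. -/
theorem dual_formulas_agree (p : Multiset ℕ)
    (hp : IsPartition p) (hodd : Odd p.sum) (horth : IsOrthogonal p) :
    ∀ q r : Multiset ℕ,
      IsCCollapse (pMinus p) q → IsCCollapse (pMinus (transposeP p)) r →
      transposeP q = r := by
  intro q r hq hr
  rw [hq.unique (isCCollapse_collapseMinus hp hodd)]
  exact (isCCollapse_transposeP_collapseMinus hodd horth).unique hr
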